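/- (Dotterrer–Kaufman–Wagner) For every d ≥ 1 and every ε > 0 there exists ε' > 0 such that every finite pure d-dimensional simplicial complex X which is an ε-cosystolic expander is an ε'-topological expander. -/

import Mathlib

open Finset
open scoped Classical

variable {V : Type}

/-- The `i`-cells of a simplicial complex `X`: faces of size `i+1`. -/
def cells [DecidableEq V] (X : Finset (Finset V)) (i : ℕ) : Finset (Finset V) :=
  X.filter fun F => F.card = i + 1

/-- `deg(F)`: the number of `d`-cells of `X` containing `F`. -/
def faceDeg [DecidableEq V] (X : Finset (Finset V)) (d : ℕ) (F : Finset V) : ℕ :=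
  (X.filter fun G => G.card = d + 1 ∧ F ⊆ G).card

/-- The weight of an `i`-cell `F`: `w(F) = deg(F)/(C(d+1,i+1)·|X^{(d)}|)`. -/
noncomputable def wt [DecidableEq V] (X : Finset (Finset V)) (d i : ℕ) (F : Finset V) : ℝ :=
  (faceDeg X d F : ℝ) / (((d + 1).choose (i + 1) : ℝ) * ((cells X d).card : ℝ))

/-- The norm of an `i`-cochain `f ∈ Cⁱ(X,F₂)`: `‖f‖ = ∑_{F ∈ X^{(i)}, f F ≠ 0} w(F)`. -/
noncomputable def normC [DecidableEq V] (X : Finset (Finset V)) (d i : ℕ)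
    (f : Finset V → ZMod 2) : ℝ :=
  ∑ F ∈ (cells X i).filter (fun F => f F ≠ 0), wt X d i F

/-- `(dlt j g)(F) = ∑_{G ⊆ F, |G| = j} g(G)`; the coboundary `δ_i` is `dlt (i+1)`,
and `δ_{i-1}` (including the augmentation `δ_{-1}` for `i = 0`) is `dlt i`. -/
def dlt [DecidableEq V] (j : ℕ) (g : Finset V → ZMod 2) (F : Finset V) : ZMod 2 :=
  ∑ G ∈ F.powersetCard j, g G

/-- Membership of an `i`-cochain in `Bⁱ = im δ_{i-1}` (agreement on all `i`-cells). -/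
def MemB [DecidableEq V] (X : Finset (Finset V)) (i : ℕ) (f : Finset V → ZMod 2) : Prop :=
  ∃ g : Finset V → ZMod 2, ∀ F ∈ cells X i, f F = dlt i g F

/-- `‖[f]‖`: the minimal norm over the coset `f + Bⁱ`. -/
noncomputable def distB [DecidableEq V] (X : Finset (Finset V)) (d i : ℕ)
    (f : Finset V → ZMod 2) : ℝ :=
  sInf {r : ℝ | ∃ g : Finset V → ZMod 2, r = normC X d i (fun F => f F + dlt i g F)}

/-- The geometric realization of `X`, as a subset of `ℝ^V`. -/
def realization [Fintype V] [DecidableEq V] (X : Finset (Finset V)) : Set (V → ℝ) :=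
  {x | (∀ v, 0 ≤ x v) ∧ (∑ v, x v) = 1 ∧ (Finset.univ.filter fun v => x v ≠ 0) ∈ X}

/-- `|σ|`: the points of the geometric realization supported on the face `σ`. -/
def faceReal [Fintype V] [DecidableEq V] (X : Finset (Finset V)) (σ : Finset V) :
    Set (V → ℝ) :=
  {x ∈ realization X | ∀ v, x v ≠ 0 → v ∈ σ}

/-- Membership of an `i`-cochain in `Zⁱ = ker δ_i` (the coboundary vanishes on all
`(i+1)`-cells of `X`). -/
def MemZ [DecidableEq V] (X : Finset (Finset V)) (i : ℕ) (f : Finset V → ZMod 2) : Prop :=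
  ∀ F ∈ cells X (i + 1), dlt (i + 1) f F = 0

/-- `‖⌈f⌉‖`: the minimal norm over the coset `f + Zⁱ`. -/
noncomputable def distZ [DecidableEq V] (X : Finset (Finset V)) (d i : ℕ)
    (f : Finset V → ZMod 2) : ℝ :=
  sInf {r : ℝ | ∃ z : Finset V → ZMod 2, MemZ X i z ∧
    r = normC X d i (fun F => f F + z F)}

/-! ### Cochains on ordered tuples -/

section ListCochains

variable {E P : Type*}

/-- The (augmented) coboundary of a mod 2 cochain on ordered tuples. -/
def cobd : (List E → ZMod 2) → List E → ZMod 2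
  | _, [] => 0
  | c, a :: L => c L + cobd (fun M => c (a :: M)) L

@[simp] theorem cobd_nil (c : List E → ZMod 2) : cobd c [] = 0 := rfl

theorem cobd_cons (c : List E → ZMod 2) (a : E) (L : List E) :
    cobd c (a :: L) = c L + cobd (fun M => c (a :: M)) L := rfl

theorem cobd_add (c c' : List E → ZMod 2) (L : List E) :
    cobd (fun M => c M + c' M) L = cobd c L + cobd c' L := by
  induction L generalizing c c' with
  | nil => simp
  | cons a L ih => simp only [cobd_cons, ih]; ring

theorem cobd_mul_left (x : ZMod 2) (c : List E → ZMod 2) (L : List E) :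
    cobd (fun M => x * c M) L = x * cobd c L := by
  induction L generalizing c with
  | nil => simp
  | cons a L ih => simp only [cobd_cons, ih]; ring

theorem cobd_congr {c c' : List E → ZMod 2} {L : List E}
    (h : ∀ M, M.Sublist L → M.length + 1 = L.length → c M = c' M) :
    cobd c L = cobd c' L := by
  induction L generalizing c c' with
  | nil => rfl
  | cons a L ih =>
    rw [cobd_cons, cobd_cons, h L (List.sublist_cons_self a L) rfl]
    congr 1
    exact ih fun M hM hl => h (a :: M) (hM.cons_cons a) (by simp [hl])

theorem cobd_zero (L : List E) : cobd (fun _ => 0) L = 0 := by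
  induction L with
  | nil => rfl
  | cons a L ih => simpa [cobd_cons] using ih

theorem cobd_cobd (c : List E → ZMod 2) (L : List E) : cobd (cobd c) L = 0 := by
  induction L generalizing c with
  | nil => rfl
  | cons a L ih =>
    simp only [cobd_cons, cobd_add, ih]
    rw [add_zero, CharTwo.add_self_eq_zero]

theorem exists_sublist_of_cobd_ne_zero {c : List E → ZMod 2} {L : List E} (h : cobd c L ≠ 0) :
    ∃ M, M.Sublist L ∧ M.length + 1 = L.length ∧ c M ≠ 0 := by
  by_contra! hn
  exact h ((cobd_congr fun M hM hl => hn M hM hl).trans (cobd_zero L))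

theorem cobd_comp_map (r : E → P) (c : List P → ZMod 2) (L : List E) :
    cobd (fun M => c (M.map r)) L = cobd c (L.map r) := by
  induction L generalizing c with
  | nil => rfl
  | cons a L ih =>
    simp only [List.map_cons, cobd_cons]
    rw [ih (fun M => c (r a :: M))]

theorem cobd_eq_sum_erase [DecidableEq E] (c : List E → ZMod 2) {L : List E} (hL : L.Nodup) :
    cobd c L = (L.map fun v => c (L.erase v)).sum := by
  induction L generalizing c with
  | nil => rfl
  | cons a L ih =>
    rw [List.nodup_cons] at hL
    rw [cobd_cons, ih _ hL.2, List.map_cons, List.sum_cons, List.erase_cons_head]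
    congr 2
    refine List.map_congr_left fun v hv => ?_
    rw [List.erase_cons_tail]
    simpa using fun h : a = v => hL.1 (h ▸ hv)

/-- Iterated coning from the apexes `b L`: the subdivision operator on tuples of length `n`. -/
def sdAux (b : List E → E) : ℕ → (List E → ZMod 2) → List E → ZMod 2
  | 0, c => c
  | n + 1, c => fun L => cobd (sdAux b n fun M => c (b L :: M)) L

theorem sdAux_succ (b : List E → E) (n : ℕ) (c : List E → ZMod 2) (L : List E) :
    sdAux b (n + 1) c L = cobd (sdAux b n fun M => c (b L :: M)) L := rfl

theorem sdAux_add (b : List E → E) (n : ℕ) (c c' : List E → ZMod 2) (L : List E) :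
    sdAux b n (fun M => c M + c' M) L = sdAux b n c L + sdAux b n c' L := by
  induction n generalizing c c' L with
  | zero => rfl
  | succ n ih =>
    simp only [sdAux_succ]
    rw [← cobd_add]
    exact cobd_congr fun M _ _ => ih _ _ M

theorem sdAux_cobd (b : List E → E) (n : ℕ) (c : List E → ZMod 2) (L : List E) :
    sdAux b (n + 1) (cobd c) L = cobd (sdAux b n c) L := by
  induction n generalizing c L with
  | zero =>
    simp only [sdAux, cobd_cons]
    rw [cobd_add, cobd_cobd, add_zero]
  | succ n ih =>
    rw [sdAux_succ]
    simp only [cobd_cons]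
    have h : ∀ M, sdAux b (n + 1) (fun M => c M + cobd (fun M => c (b L :: M)) M) M =
        sdAux b (n + 1) c M + cobd (sdAux b n fun M => c (b L :: M)) M := fun M => by
      rw [sdAux_add]; congr 1; exact ih _ M
    rw [funext h, cobd_add, cobd_cobd, add_zero]

/-- Pullback of a cochain along the subdivision of tuples with apexes given by `b`. -/
def sd (b : List E → E) (c : List E → ZMod 2) (L : List E) : ZMod 2 := sdAux b L.length c L

theorem cobd_sd (b : List E → E) (c : List E → ZMod 2) : cobd (sd b c) = sd b (cobd c) := by
  funext L
  cases L with
  | nil => rfl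
  | cons a L =>
    rw [sd, List.length_cons, sdAux_cobd]
    refine cobd_congr fun M _ hl => ?_
    rw [sd, Nat.succ_injective hl]

theorem cobd_sd_iterate (b : List E → E) (N : ℕ) (c : List E → ZMod 2) :
    cobd ((sd b)^[N] c) = (sd b)^[N] (cobd c) := by
  induction N generalizing c with
  | zero => rfl
  | succ N ih => rw [Function.iterate_succ_apply, ih, cobd_sd, ← Function.iterate_succ_apply]

theorem sd_zero (b : List E → E) : sd b (fun _ => 0) = fun _ => 0 := by
  have : ∀ n L, sdAux b n (fun _ => 0) L = 0 := by
    intro n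
    induction n with
    | zero => intro L; rfl
    | succ n ih => intro L; rw [sdAux_succ, funext ih, cobd_zero]
  funext L
  exact this _ L

theorem sd_add (b : List E → E) (c c' : List E → ZMod 2) :
    sd b (fun M => c M + c' M) = fun M => sd b c M + sd b c' M :=
  funext fun L => sdAux_add b _ c c' L

theorem sd_iterate_zero (b : List E → E) (N : ℕ) : (sd b)^[N] (fun _ => 0) = fun _ => 0 :=
  Function.iterate_fixed (sd_zero b) N

theorem sd_iterate_add (b : List E → E) (N : ℕ) (c c' : List E → ZMod 2) :
    (sd b)^[N] (fun M => c M + c' M) = fun M => (sd b)^[N] c M + (sd b)^[N] c' M := by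
  induction N generalizing c c' with
  | zero => rfl
  | succ N ih => simp only [Function.iterate_succ_apply, sd_add, ih]

theorem sd_iterate_sum {ι : Type*} (b : List E → E) (N : ℕ) (s : Finset ι)
    (c : ι → List E → ZMod 2) :
    (sd b)^[N] (fun M => ∑ i ∈ s, c i M) = fun M => ∑ i ∈ s, (sd b)^[N] (c i) M := by
  induction s using Finset.induction_on with
  | empty => simpa using sd_iterate_zero b N
  | insert i s hi ih => simp only [Finset.sum_insert hi, sd_iterate_add, ih]

theorem sd_iterate_singleton (b : List E → E) (hb : ∀ x, b [x] = x) (N : ℕ)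
    (c : List E → ZMod 2) (x : E) : (sd b)^[N] c [x] = c [x] := by
  induction N generalizing c with
  | zero => rfl
  | succ N ih =>
    rw [Function.iterate_succ_apply, ih]
    simp [sd, sdAux, cobd_cons, hb]

end ListCochains

/-! ### Barycentric subdivision -/

section Barycentric

variable {E : Type*} [NormedAddCommGroup E] [NormedSpace ℝ E]

/-- The barycenter of a tuple of points. -/
noncomputable def barycenter (L : List E) : E := (L.length : ℝ)⁻¹ • L.sum

theorem barycenter_singleton (x : E) : barycenter [x] = x := by simp [barycenter]

theorem barycenter_mem {s : Set E} (hs : Convex ℝ s) {L : List E} (hL : ∀ x ∈ L, x ∈ s)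
    (hne : L ≠ []) : barycenter L ∈ s := by
  have hpos : (0 : ℝ) < L.length := by exact_mod_cast List.length_pos_iff.2 hne
  have key : barycenter L = ∑ i : Fin L.length, (L.length : ℝ)⁻¹ • L[i] := by
    rw [barycenter, ← Finset.smul_sum, ← List.sum_ofFn]
    congr 2
    exact List.ofFn_getElem.symm
  rw [key]
  refine hs.sum_mem (fun _ _ => by positivity) ?_ fun i _ => hL _ (List.getElem_mem _)
  simp [hpos.ne']

theorem norm_sum_map_sub_le {L : List E} {D : ℝ} {v : E} (h : ∀ x ∈ L, ‖x - v‖ ≤ D) :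
    ‖L.sum - (L.length : ℝ) • v‖ ≤ L.length * D := by
  induction L with
  | nil => simp
  | cons a L ih =>
    have h1 := h a List.mem_cons_self
    have h2 := ih fun x hx => h x (List.mem_cons_of_mem a hx)
    have : (a :: L).sum - ((a :: L).length : ℝ) • v = (a - v) + (L.sum - (L.length : ℝ) • v) := by
      simp only [List.sum_cons, List.length_cons, Nat.cast_add, Nat.cast_one, add_smul, one_smul]
      abel
    rw [this]
    refine (norm_add_le _ _).trans ?_
    simp only [List.length_cons, Nat.cast_add, Nat.cast_one]
    linarith

theorem dist_barycenter_le {L : List E} {D : ℝ} (h : ∀ x ∈ L, ∀ y ∈ L, dist x y ≤ D)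
    {v : E} (hv : v ∈ L) : dist v (barycenter L) ≤ (1 - (L.length : ℝ)⁻¹) * D := by
  classical
  have hpos : (0 : ℝ) < L.length := by exact_mod_cast List.length_pos_of_mem hv
  have hp := List.perm_cons_erase hv
  have hlen : (L.length : ℝ) = (L.erase v).length + 1 := by
    exact_mod_cast hp.length_eq
  have hsum : L.sum = v + (L.erase v).sum := by rw [hp.sum_eq, List.sum_cons]
  have key := norm_sum_map_sub_le (L := L.erase v) (v := v) (D := D) fun x hx => by
    rw [← dist_eq_norm]; exact h x (List.mem_of_mem_erase hx) v hv
  have e : barycenter L - v = (L.length : ℝ)⁻¹ • ((L.erase v).sum - ((L.erase v).length : ℝ) • v) := by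
    have : v = (L.length : ℝ)⁻¹ • ((L.length : ℝ) • v) := by rw [inv_smul_smul₀ hpos.ne']
    conv_lhs => rw [this]
    rw [barycenter, ← smul_sub, hsum, hlen, add_smul, one_smul]
    congr 1; abel
  rw [dist_comm, dist_eq_norm, e, norm_smul, norm_inv, Real.norm_of_nonneg hpos.le]
  refine (mul_le_mul_of_nonneg_left key (by positivity)).trans (le_of_eq ?_)
  have : ((L.erase v).length : ℝ) = L.length - 1 := by linarith
  rw [this]; field_simp

theorem exists_small_of_sdAux_ne_zero {d : ℕ} {s : Set E} (hs : Convex ℝ s) {D : ℝ} (n : ℕ)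
    (hn : n ≤ d + 1)
    (c : List E → ZMod 2) (L : List E) (hl : L.length = n) (hL : ∀ x ∈ L, x ∈ s)
    (hD : ∀ x ∈ L, ∀ y ∈ L, dist x y ≤ D) (hD0 : 0 ≤ D) (h : sdAux barycenter n c L ≠ 0) :
    ∃ M : List E, M.length = n ∧ (∀ x ∈ M, x ∈ s) ∧
      (∀ x ∈ M, ∀ y ∈ M, dist x y ≤ (1 - ((d : ℝ) + 1)⁻¹) * D) ∧ c M ≠ 0 := by
  induction n generalizing c L s with
  | zero =>
    obtain rfl := List.length_eq_zero_iff.1 hl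
    exact ⟨[], rfl, by simp, by simp, h⟩
  | succ n ih =>
    obtain ⟨L', hsub, hlen, hne⟩ := exists_sublist_of_cobd_ne_zero h
    have hrad : (1 - (L.length : ℝ)⁻¹) * D ≤ (1 - ((d : ℝ) + 1)⁻¹) * D := by
      gcongr
      · rw [hl]; positivity
      · rw [hl]; exact_mod_cast hn
    have hball : ∀ x ∈ L, x ∈ Metric.closedBall (barycenter L) ((1 - ((d : ℝ) + 1)⁻¹) * D) :=
      fun x hx => (dist_barycenter_le hD hx).trans hrad
    obtain ⟨M, hM1, hM2, hM3, hM4⟩ := ih (hs.inter (convex_closedBall (barycenter L) _))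
      (by omega) _ L' (by omega)
      (fun x hx => ⟨hL x (hsub.subset hx), hball x (hsub.subset hx)⟩)
      (fun x hx y hy => hD x (hsub.subset hx) y (hsub.subset hy)) hne
    have hr0 : 0 ≤ (1 - ((d : ℝ) + 1)⁻¹) * D := by
      refine mul_nonneg (sub_nonneg.2 (inv_le_one_of_one_le₀ ?_)) hD0
      have : (0 : ℝ) ≤ d := Nat.cast_nonneg d
      linarith
    refine ⟨barycenter L :: M, by simp [hM1], ?_, ?_, hM4⟩
    · intro x hx
      rcases List.mem_cons.1 hx with rfl | hx
      · exact barycenter_mem hs hL (by rintro rfl; simp at hl)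
      · exact (hM2 x hx).1
    · intro x hx y hy
      rcases List.mem_cons.1 hx with rfl | hx <;> rcases List.mem_cons.1 hy with rfl | hy
      · simpa using hr0
      · rw [dist_comm]; exact (hM2 y hy).2
      · exact (hM2 x hx).2
      · exact hM3 x hx y hy

theorem exists_small_of_sd_iterate_ne_zero {d : ℕ} {s : Set E} (hs : Convex ℝ s) {D : ℝ}
    (hD0 : 0 ≤ D) (N : ℕ) (c : List E → ZMod 2) (L : List E) (hl : L.length ≤ d + 1)
    (hL : ∀ x ∈ L, x ∈ s) (hD : ∀ x ∈ L, ∀ y ∈ L, dist x y ≤ D)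
    (h : (sd barycenter)^[N] c L ≠ 0) :
    ∃ M : List E, M.length = L.length ∧ (∀ x ∈ M, x ∈ s) ∧
      (∀ x ∈ M, ∀ y ∈ M, dist x y ≤ (1 - ((d : ℝ) + 1)⁻¹) ^ N * D) ∧ c M ≠ 0 := by
  induction N generalizing c with
  | zero => exact ⟨L, rfl, hL, by simpa using hD, h⟩
  | succ N ih =>
    rw [Function.iterate_succ_apply] at h
    obtain ⟨M, h1, h2, h3, h4⟩ := ih _ h
    have hr : (0 : ℝ) ≤ 1 - ((d : ℝ) + 1)⁻¹ := by
      refine sub_nonneg.2 (inv_le_one_of_one_le₀ ?_)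
      have : (0 : ℝ) ≤ d := Nat.cast_nonneg d
      linarith
    obtain ⟨M', h1', h2', h3', h4'⟩ := exists_small_of_sdAux_ne_zero (d := d) hs M.length
      (h1 ▸ hl) c M rfl h2 h3 (by positivity) h4
    refine ⟨M', h1'.trans h1, h2', fun x hx y hy => (h3' x hx y hy).trans_eq ?_, h4'⟩
    ring

end Barycentric

/-! ### Intersection cochains of the cells of the cubical grid

A cell of the grid `ℤ^d` is encoded by `t : Fin d → ℤ`: an even coordinate `2 * i` stands for the
hyperplane separating `i - 1` from `i`, an odd coordinate `2 * i + 1` for the slab over `i`. -/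

section Grid

variable {P : Type*}

/-- Cup product with the `0`-cochain `h`. -/
def mulHead (h : P → ZMod 2) (c : List P → ZMod 2) : List P → ZMod 2
  | [] => 0
  | u :: L => h u * c (u :: L)

/-- Cup product with the coboundary of the `0`-cochain `h`. -/
def mulJump (h : P → ZMod 2) (c : List P → ZMod 2) : List P → ZMod 2
  | [] => 0
  | [_] => 0
  | u :: v :: L => (h u + h v) * c (v :: L)

theorem cobd_mulHead (h : P → ZMod 2) {c : List P → ZMod 2} (hc : c [] = 0) (L : List P) :
    cobd (mulHead h c) L = mulHead h (cobd c) L + mulJump h c L := by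
  match L with
  | [] => simp [mulHead, mulJump]
  | [u] => simp [mulHead, mulJump, cobd_cons, hc]
  | u :: v :: L =>
    have h2 : ∀ M, mulHead h c (u :: M) = h u * c (u :: M) := fun M => rfl
    rw [cobd_cons, funext h2, cobd_mul_left]
    simp only [mulHead, mulJump]
    rw [cobd_cons c u]
    linear_combination (-(h u) * c (v :: L)) * (CharTwo.two_eq_zero (R := ZMod 2))

theorem cobd_mulJump (h : P → ZMod 2) {c : List P → ZMod 2} (hc : c [] = 0) (L : List P) :
    cobd (mulJump h c) L = mulJump h (cobd c) L := by
  have e : mulJump h c = fun M => cobd (mulHead h c) M + mulHead h (cobd c) M := by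
    funext M
    rw [cobd_mulHead h hc, add_right_comm, CharTwo.add_self_eq_zero, zero_add]
  have z : mulHead h (cobd (cobd c)) L = 0 := by
    cases L with
    | nil => rfl
    | cons u L => rw [mulHead, cobd_cobd, mul_zero]
  rw [e, cobd_add, cobd_cobd, zero_add, cobd_mulHead h (cobd_nil c), z, zero_add]

variable {d : ℕ}

/-- Cup product with the cochain of the `k`-th factor of the cell `t`. -/
def cellFactor (t : Fin d → ℤ) (k : Fin d) (c : List (Fin d → ℤ) → ZMod 2) :
    List (Fin d → ℤ) → ZMod 2 :=
  if Even (t k) then mulJump (fun u => if 2 * u k < t k then 1 else 0) c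
  else mulHead (fun u => if 2 * u k + 1 = t k then 1 else 0) c

/-- The intersection cochain of the projection of the cell `t` to the coordinates `ks`. -/
def cellCochain (t : Fin d → ℤ) : List (Fin d) → List (Fin d → ℤ) → ZMod 2
  | [] => fun L => if L.length = 1 then 1 else 0
  | k :: ks => cellFactor t k (cellCochain t ks)

theorem exists_cellFactor_eq_mul (t : Fin d → ℤ) (k : Fin d) (L : List (Fin d → ℤ)) :
    ∃ (x : ZMod 2) (M : List (Fin d → ℤ)), ∀ c, cellFactor t k c L = x * c M := by
  unfold cellFactor
  split_ifs
  · match L with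
    | [] => exact ⟨0, [], fun c => by simp [mulJump]⟩
    | [_] => exact ⟨0, [], fun c => by simp [mulJump]⟩
    | u :: v :: L => exact ⟨_, v :: L, fun c => rfl⟩
  · match L with
    | [] => exact ⟨0, [], fun c => by simp [mulHead]⟩
    | u :: L => exact ⟨_, u :: L, fun c => rfl⟩

theorem cellFactor_sum (t : Fin d → ℤ) (k : Fin d) (ks : List (Fin d))
    (c : Fin d → List (Fin d → ℤ) → ZMod 2) (L : List (Fin d → ℤ)) :
    cellFactor t k (fun M => (ks.map fun j => c j M).sum) L =
      (ks.map fun j => cellFactor t k (c j) L).sum := by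
  obtain ⟨x, M, h⟩ := exists_cellFactor_eq_mul t k L
  simp only [h, List.sum_map_mul_left]

theorem cellFactor_update_of_ne (t : Fin d → ℤ) {j k : Fin d} (h : k ≠ j) (a : ℤ)
    (c : List (Fin d → ℤ) → ZMod 2) :
    cellFactor (Function.update t j a) k c = cellFactor t k c := by
  simp only [cellFactor, Function.update_of_ne h]

theorem cellCochain_update_of_notMem (t : Fin d → ℤ) {j : Fin d} {ks : List (Fin d)}
    (h : j ∉ ks) (a : ℤ) : cellCochain (Function.update t j a) ks = cellCochain t ks := by
  induction ks with
  | nil => rfl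
  | cons k ks ih =>
    rw [List.mem_cons, not_or] at h
    rw [cellCochain, cellCochain, ih h.2, cellFactor_update_of_ne t (Ne.symm h.1)]

theorem cellCochain_nil_right (t : Fin d → ℤ) (ks : List (Fin d)) : cellCochain t ks [] = 0 := by
  cases ks with
  | nil => rfl
  | cons k ks =>
    rw [cellCochain, cellFactor]
    split_ifs <;> rfl

theorem cobd_cellFactor (t : Fin d → ℤ) (k : Fin d) {c : List (Fin d → ℤ) → ZMod 2}
    (hc : c [] = 0) (L : List (Fin d → ℤ)) :
    cobd (cellFactor t k c) L = cellFactor t k (cobd c) L + if Even (t k) then 0 else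
      cellFactor (Function.update t k (t k + 1)) k c L +
        cellFactor (Function.update t k (t k - 1)) k c L := by
  unfold cellFactor
  split_ifs with h h1 h2 h2
  · rw [cobd_mulJump _ hc, add_zero]
  · rw [cobd_mulHead _ hc]
    congr 1
    match L with
    | [] => simp [mulJump]
    | [_] => simp [mulJump]
    | u :: v :: L =>
      simp only [mulJump, Function.update_self]
      rw [← add_mul]
      congr 1
      have key : ∀ u : Fin d → ℤ, (if 2 * u k + 1 = t k then 1 else 0 : ZMod 2) =
          (if 2 * u k < t k + 1 then 1 else 0) + if 2 * u k < t k - 1 then 1 else 0 := by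
        intro u
        rw [Int.not_even_iff_odd] at h
        obtain ⟨i, hi⟩ := h
        rcases lt_trichotomy (u k) i with h | h | h
        · rw [if_neg (by omega), if_pos (by omega), if_pos (by omega), CharTwo.add_self_eq_zero]
        · rw [if_pos (by omega), if_pos (by omega), if_neg (by omega), add_zero]
        · rw [if_neg (by omega), if_neg (by omega), if_neg (by omega), add_zero]
      rw [key, key]
      ring
  all_goals
    exfalso
    simp only [Function.update_self, Int.even_add, Int.even_sub] at *
    simp_all

theorem cobd_cellCochain (t : Fin d → ℤ) {ks : List (Fin d)} (hks : ks.Nodup)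
    (L : List (Fin d → ℤ)) :
    cobd (cellCochain t ks) L = (ks.map fun k => if Even (t k) then 0 else
      cellCochain (Function.update t k (t k + 1)) ks L +
        cellCochain (Function.update t k (t k - 1)) ks L).sum := by
  induction ks generalizing L with
  | nil =>
    simp only [List.map_nil, List.sum_nil]
    match L with
    | [] => rfl
    | [u] => simp [cobd_cons, cellCochain]
    | [u, v] => simp [cobd_cons, cellCochain]; decide
    | u :: v :: w :: L =>
      refine (cobd_congr fun M _ hl => ?_).trans (cobd_zero _)
      simp only [List.length_cons] at hl
      rw [cellCochain]
      exact if_neg (by omega)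
  | cons k ks ih =>
    rw [List.nodup_cons] at hks
    rw [cellCochain, cobd_cellFactor t k (cellCochain_nil_right t ks), funext (ih hks.2),
      cellFactor_sum, List.map_cons, List.sum_cons, add_comm]
    congr 1
    · simp only [cellCochain, cellCochain_update_of_notMem t hks.1]
    · congr 1
      refine List.map_congr_left fun j hj => ?_
      have hjk : k ≠ j := fun h => hks.1 (h ▸ hj)
      obtain ⟨x, M, h⟩ := exists_cellFactor_eq_mul t k L
      simp only [cellCochain, cellFactor_update_of_ne t hjk, h]
      split_ifs
      · rw [mul_zero]
      · rw [mul_add]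

theorem exists_near_of_cellCochain_ne_zero (t : Fin d → ℤ) (ks : List (Fin d))
    (L : List (Fin d → ℤ)) (hL : ∀ u ∈ L, ∀ v ∈ L, ∀ k, |u k - v k| ≤ 1)
    (h : cellCochain t ks L ≠ 0) (k : Fin d) (hk : k ∈ ks) :
    ∃ u ∈ L, |2 * u k - t k| ≤ 2 := by
  induction ks generalizing L with
  | nil => simp at hk
  | cons j ks ih =>
    rw [cellCochain, cellFactor] at h
    split_ifs at h
    · match L with
      | [] => simp [mulJump] at h
      | [_] => simp [mulJump] at h
      | u :: v :: L =>
        simp only [mulJump] at h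
        rcases List.mem_cons.1 hk with rfl | hk
        · refine ⟨u, List.mem_cons_self, ?_⟩
          have h1 := hL u (by simp) v (by simp) k
          have h2 := left_ne_zero_of_mul h
          rw [abs_le] at h1 ⊢
          by_cases a1 : 2 * u k < t k <;> by_cases a2 : 2 * v k < t k
          · simp [a1, a2] at h2; exact absurd (by decide) h2
          · constructor <;> omega
          · constructor <;> omega
          · simp [a1, a2] at h2
        · obtain ⟨w, hw, hw'⟩ := ih (v :: L)
            (fun u hu v hv => hL u (List.mem_cons_of_mem _ hu) v (List.mem_cons_of_mem _ hv))
            (right_ne_zero_of_mul h) hk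
          exact ⟨w, List.mem_cons_of_mem _ hw, hw'⟩
    · match L with
      | [] => simp [mulHead] at h
      | u :: L =>
        simp only [mulHead] at h
        rcases List.mem_cons.1 hk with rfl | hk
        · refine ⟨u, List.mem_cons_self, ?_⟩
          have h2 := left_ne_zero_of_mul h
          by_cases a1 : 2 * u k + 1 = t k
          · rw [abs_le]; constructor <;> omega
          · simp [a1] at h2
        · exact ih (u :: L) hL (right_ne_zero_of_mul h) hk

theorem cellCochain_singleton (t : Fin d → ℤ) (ks : List (Fin d)) (ht : ∀ k ∈ ks, ¬ Even (t k))
    (u : Fin d → ℤ) :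
    cellCochain t ks [u] = if ∀ k ∈ ks, 2 * u k + 1 = t k then 1 else 0 := by
  induction ks with
  | nil => simp [cellCochain]
  | cons k ks ih =>
    rw [List.forall_mem_cons] at ht
    rw [cellCochain, cellFactor, if_neg ht.1, mulHead, ih ht.2]
    simp only [List.forall_mem_cons]
    split_ifs <;> simp_all

end Grid

/-! ### Cochains of a simplicial complex -/

section Cochains

variable [DecidableEq V] {X : Finset (Finset V)} {d : ℕ}

theorem dlt_add (j : ℕ) (g g' : Finset V → ZMod 2) (σ : Finset V) :
    dlt j (fun F => g F + g' F) σ = dlt j g σ + dlt j g' σ :=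
  Finset.sum_add_distrib

theorem dlt_sum {ι : Type*} (j : ℕ) (s : Finset ι) (g : ι → Finset V → ZMod 2) (σ : Finset V) :
    dlt j (fun F => ∑ i ∈ s, g i F) σ = ∑ i ∈ s, dlt j (g i) σ :=
  Finset.sum_comm

theorem dlt_zero (j : ℕ) (σ : Finset V) : dlt j (fun _ => 0) σ = 0 :=
  Finset.sum_const_zero

theorem dlt_eq_sum_erase {j : ℕ} (g : Finset V → ZMod 2) {σ : Finset V} (hσ : σ.card = j + 1) :
    dlt j g σ = ∑ v ∈ σ, g (σ.erase v) := by
  symm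
  refine Finset.sum_bij (fun v _ => σ.erase v) (fun v hv => ?_) (fun v hv w hw h => ?_)
    (fun G hG => ?_) fun _ _ => rfl
  · rw [mem_powersetCard, card_erase_of_mem hv, hσ]
    exact ⟨erase_subset _ _, rfl⟩
  · exact (Finset.erase_inj σ hv).1 h
  · rw [mem_powersetCard] at hG
    have : (σ \ G).card = 1 := by rw [card_sdiff_of_subset hG.1]; omega
    obtain ⟨v, hv⟩ := card_eq_one.1 this
    refine ⟨v, (mem_sdiff.1 (hv ▸ mem_singleton_self v)).1, ?_⟩
    rw [← sdiff_singleton_eq_erase, ← hv, Finset.sdiff_sdiff_eq_self hG.1]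

/-- The vertices of a face, in a fixed order. -/
noncomputable def vertexList [Fintype V] (F : Finset V) : List V :=
  (univ : Finset V).toList.filter fun v => v ∈ F

section

variable [Fintype V]

@[simp] theorem mem_vertexList {F : Finset V} {v : V} : v ∈ vertexList F ↔ v ∈ F := by
  simp [vertexList]

theorem nodup_vertexList (F : Finset V) : (vertexList F).Nodup :=
  (nodup_toList _).filter _

theorem vertexList_toFinset (F : Finset V) : (vertexList F).toFinset = F := by
  ext v; simp

theorem length_vertexList (F : Finset V) : (vertexList F).length = F.card := by
  rw [← List.toFinset_card_of_nodup (nodup_vertexList F), vertexList_toFinset]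

theorem vertexList_erase (F : Finset V) (v : V) : vertexList (F.erase v) = (vertexList F).erase v := by
  rw [(nodup_vertexList F).erase_eq_filter]
  simp only [vertexList, List.filter_filter]
  refine List.filter_congr fun w _ => ?_
  rw [Bool.eq_iff_iff]
  simp

theorem vertexList_singleton (v : V) : vertexList {v} = [v] := by
  have h := length_vertexList ({v} : Finset V)
  rw [card_singleton, List.length_eq_one_iff] at h
  obtain ⟨a, ha⟩ := h
  have : a ∈ vertexList {v} := by simp [ha]
  rw [mem_vertexList, mem_singleton] at this
  rw [ha, this]

theorem dlt_comp_vertexList {j : ℕ} (c : List V → ZMod 2) {σ : Finset V} (hσ : σ.card = j + 1) :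
    dlt j (fun F => c (vertexList F)) σ = cobd c (vertexList σ) := by
  rw [dlt_eq_sum_erase _ hσ, cobd_eq_sum_erase c (nodup_vertexList σ),
    ← List.sum_toFinset _ (nodup_vertexList σ), vertexList_toFinset]
  simp only [vertexList_erase]

end

theorem wt_nonneg (X : Finset (Finset V)) (d i : ℕ) (F : Finset V) : 0 ≤ wt X d i F := by
  unfold wt; positivity

theorem normC_eq_sum_ite (X : Finset (Finset V)) (d i : ℕ) (f : Finset V → ZMod 2) :
    normC X d i f = ∑ F ∈ cells X i, if f F ≠ 0 then wt X d i F else 0 :=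
  Finset.sum_filter _ _

theorem normC_nonneg (X : Finset (Finset V)) (d i : ℕ) (f : Finset V → ZMod 2) :
    0 ≤ normC X d i f :=
  Finset.sum_nonneg fun F _ => wt_nonneg X d i F

theorem normC_zero (X : Finset (Finset V)) (d i : ℕ) : normC X d i (fun _ => 0) = 0 := by
  simp [normC]

theorem normC_congr {i : ℕ} {f g : Finset V → ZMod 2} (h : ∀ F ∈ cells X i, f F = g F) :
    normC X d i f = normC X d i g := by
  rw [normC_eq_sum_ite, normC_eq_sum_ite]
  exact Finset.sum_congr rfl fun F hF => by rw [h F hF]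

theorem normC_add_le (X : Finset (Finset V)) (d i : ℕ) (f g : Finset V → ZMod 2) :
    normC X d i (fun F => f F + g F) ≤ normC X d i f + normC X d i g := by
  simp only [normC_eq_sum_ite, ← Finset.sum_add_distrib]
  refine Finset.sum_le_sum fun F _ => ?_
  have := wt_nonneg X d i F
  by_cases h1 : f F = 0 <;> by_cases h2 : g F = 0 <;> simp [h1, h2]
  split_ifs <;> linarith

theorem normC_sum_le {ι : Type*} (X : Finset (Finset V)) (d i : ℕ) (s : Finset ι)
    (f : ι → Finset V → ZMod 2) :
    normC X d i (fun F => ∑ k ∈ s, f k F) ≤ ∑ k ∈ s, normC X d i (f k) := by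
  induction s using Finset.induction_on with
  | empty => simp [normC_zero]
  | insert a s ha ih =>
    simp only [Finset.sum_insert ha]
    exact (normC_add_le X d i _ _).trans (by linarith)

theorem faceDeg_eq (X : Finset (Finset V)) (d : ℕ) (F : Finset V) :
    faceDeg X d F = ((cells X d).filter fun τ => F ⊆ τ).card := by
  rw [faceDeg, cells, filter_filter]

theorem normC_eq_double_count (hX : ∀ F ∈ X, ∀ G ⊆ F, G ∈ X) (i : ℕ) (f : Finset V → ZMod 2) :
    normC X d i f = (∑ τ ∈ cells X d, (((τ.powersetCard (i + 1)).filter fun F => f F ≠ 0).card : ℝ)) /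
      (((d + 1).choose (i + 1) : ℝ) * ((cells X d).card : ℝ)) := by
  unfold normC wt
  rw [← Finset.sum_div]
  congr 1
  simp only [faceDeg_eq]
  have h1 : ∀ F, (((cells X d).filter fun τ => F ⊆ τ).card : ℝ) =
      ∑ τ ∈ cells X d, if F ⊆ τ then (1 : ℝ) else 0 := fun F => by simp
  simp only [h1]
  rw [Finset.sum_comm]
  refine Finset.sum_congr rfl fun τ hτ => ?_
  rw [← Finset.sum_filter, Finset.sum_const, nsmul_one, filter_filter]
  congr 2
  ext F
  simp only [mem_filter, cells, mem_powersetCard] at hτ ⊢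
  constructor
  · rintro ⟨⟨_, h2⟩, h3, h4⟩; exact ⟨⟨h4, h2⟩, h3⟩
  · rintro ⟨⟨h4, h2⟩, h3⟩; exact ⟨⟨hX τ hτ.1 F h4, h2⟩, h3, h4⟩

theorem normC_eq_one (hX : ∀ F ∈ X, ∀ G ⊆ F, G ∈ X) (hne : (cells X d).Nonempty)
    {f : Finset V → ZMod 2} (hf : ∀ F ∈ cells X 0, f F ≠ 0) : normC X d 0 f = 1 := by
  rw [normC_eq_double_count hX]
  have : ∀ τ ∈ cells X d, (((τ.powersetCard (0 + 1)).filter fun F => f F ≠ 0).card : ℝ) =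
      (d + 1).choose (0 + 1) := fun τ hτ => by
    have h := hτ
    simp only [cells, mem_filter] at h
    rw [filter_true_of_mem, card_powersetCard, h.2]
    intro F hF
    rw [mem_powersetCard] at hF
    exact hf F (by simp only [cells, mem_filter]; exact ⟨hX τ h.1 F hF.1, hF.2⟩)
  rw [Finset.sum_congr rfl this, Finset.sum_const, nsmul_eq_mul, mul_comm]
  refine div_self (mul_ne_zero ?_ ?_)
  · simp; positivity
  · exact_mod_cast hne.card_pos.ne'

theorem normC_le_of_support (hX : ∀ F ∈ X, ∀ G ⊆ F, G ∈ X) {i : ℕ} (hi : i ≤ d)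
    {f : Finset V → ZMod 2} {S : Finset (Finset V)}
    (hS : ∀ τ ∈ cells X d, ∀ F ⊆ τ, F.card = i + 1 → f F ≠ 0 → τ ∈ S) {η : ℝ}
    (hη : (((cells X d).filter fun τ => τ ∈ S).card : ℝ) ≤ η * (cells X d).card) (hη0 : 0 ≤ η) :
    normC X d i f ≤ η := by
  rw [normC_eq_double_count hX]
  have hC : (0 : ℝ) < (d + 1).choose (i + 1) := by
    exact_mod_cast Nat.choose_pos (by omega)
  have key : ∑ τ ∈ cells X d, (((τ.powersetCard (i + 1)).filter fun F => f F ≠ 0).card : ℝ) ≤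
      ∑ τ ∈ cells X d, if τ ∈ S then ((d + 1).choose (i + 1) : ℝ) else 0 := by
    refine Finset.sum_le_sum fun τ hτ => ?_
    split_ifs with h
    · rw [← (mem_filter.1 hτ).2, ← card_powersetCard]
      exact_mod_cast card_filter_le _ _
    · rw [filter_false_of_mem]
      · simp
      · intro F hF h'
        rw [mem_powersetCard] at hF
        exact h (hS τ hτ F hF.1 hF.2 h')
  rw [← Finset.sum_filter, Finset.sum_const, nsmul_eq_mul] at key
  refine div_le_of_le_mul₀ (by positivity) hη0 (key.trans ?_)
  nlinarith

theorem exists_small_primitive {ε : ℝ} (hε : 0 < ε) {i : ℕ}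
    (hν : ∀ f : Finset V → ZMod 2, ¬ MemZ X i f →
      ε ≤ normC X d (i + 1) (dlt (i + 1) f) / distZ X d i f)
    {c : Finset V → ZMod 2} (hc : MemB X (i + 1) c) :
    ∃ g : Finset V → ZMod 2, (∀ σ ∈ cells X (i + 1), dlt (i + 1) g σ = c σ) ∧
      normC X d i g ≤ 2 / ε * normC X d (i + 1) c := by
  obtain ⟨g, hg⟩ := hc
  by_cases hz : MemZ X i g
  · refine ⟨fun _ => 0, fun σ hσ => ?_, ?_⟩
    · rw [dlt_zero, hg σ hσ, hz σ hσ]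
    · rw [normC_zero]
      exact mul_nonneg (by positivity) (normC_nonneg _ _ _ _)
  · have h := hν g hz
    rw [← normC_congr hg] at h
    set n := normC X d (i + 1) c with hn
    have hn0 : 0 ≤ n := normC_nonneg _ _ _ _
    set S := {r : ℝ | ∃ z : Finset V → ZMod 2, MemZ X i z ∧
      r = normC X d i (fun F => g F + z F)} with hS
    have hD : distZ X d i g = sInf S := rfl
    have hD0 : 0 ≤ sInf S := Real.sInf_nonneg (by rintro r ⟨z, _, rfl⟩; exact normC_nonneg _ _ _ _)
    rw [hD] at h
    have hD1 : 0 < sInf S := by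
      refine hD0.lt_of_ne fun h0 => ?_
      rw [← h0, div_zero] at h
      linarith
    rw [le_div_iff₀ hD1] at h
    have hlt : sInf S < 2 / ε * n := by
      rw [div_mul_eq_mul_div, lt_div_iff₀ hε]
      nlinarith
    have hne : S.Nonempty := ⟨_, fun _ => 0, fun F _ => dlt_zero _ F, rfl⟩
    obtain ⟨r, ⟨z, hz', rfl⟩, hr⟩ := exists_lt_of_csInf_lt hne hlt
    refine ⟨_, fun σ hσ => ?_, hr.le⟩
    rw [dlt_add, hz' σ hσ, add_zero, hg σ hσ]

end Cochains

/-! ### Boundaries of grid cells -/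

section GridBoundary

variable {d : ℕ}

/-- The directions in which the cell `t` is extended. -/
def oddDirs (t : Fin d → ℤ) : Finset (Fin d) := univ.filter fun k => ¬ Even (t k)

/-- The sum of `h` over the boundary of the cell `t`. -/
def bdrySum (h : (Fin d → ℤ) → ZMod 2) (t : Fin d → ℤ) : ZMod 2 :=
  ∑ k ∈ oddDirs t, (h (Function.update t k (t k + 1)) + h (Function.update t k (t k - 1)))

theorem mem_oddDirs {t : Fin d → ℤ} {k : Fin d} : k ∈ oddDirs t ↔ ¬ Even (t k) := by
  simp [oddDirs]

theorem oddDirs_update_even (t : Fin d → ℤ) (k : Fin d) {a : ℤ} (ha : Even a) :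
    oddDirs (Function.update t k a) = (oddDirs t).erase k := by
  ext l
  rw [mem_oddDirs, mem_erase, mem_oddDirs]
  by_cases h : l = k
  · subst h; simp [ha]
  · simp [h]

theorem even_add_one_of_mem {t : Fin d → ℤ} {k : Fin d} (h : k ∈ oddDirs t) : Even (t k + 1) :=
  Int.even_add_one.2 (mem_oddDirs.1 h)

theorem even_sub_one_of_mem {t : Fin d → ℤ} {k : Fin d} (h : k ∈ oddDirs t) : Even (t k - 1) :=
  Int.even_sub_one.2 (mem_oddDirs.1 h)

theorem sum_sum_erase_eq_zero {ι : Type*} [DecidableEq ι] (s : Finset ι) (Φ : ι → ι → ZMod 2)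
    (hΦ : ∀ k l, k ≠ l → Φ k l = Φ l k) : ∑ k ∈ s, ∑ l ∈ s.erase k, Φ k l = 0 := by
  rw [Finset.sum_sigma']
  refine Finset.sum_involution (fun x _ => ⟨x.2, x.1⟩) ?_ ?_ ?_ ?_
  · rintro ⟨k, l⟩ h
    simp only [mem_sigma, mem_erase] at h
    rw [hΦ k l (Ne.symm h.2.1), CharTwo.add_self_eq_zero]
  · rintro ⟨k, l⟩ h _ h'
    simp only [mem_sigma, mem_erase] at h
    simp only [Sigma.mk.injEq] at h'
    exact h.2.1 h'.1
  · rintro ⟨k, l⟩ h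
    simp only [mem_sigma, mem_erase] at h ⊢
    exact ⟨h.2.2, Ne.symm h.2.1, h.1⟩
  · rintro ⟨k, l⟩ _; rfl

theorem bdrySum_bdrySum (h : (Fin d → ℤ) → ZMod 2) (t : Fin d → ℤ) :
    bdrySum (bdrySum h) t = 0 := by
  have key : bdrySum (bdrySum h) t = ∑ k ∈ oddDirs t, ∑ l ∈ (oddDirs t).erase k,
      (h (Function.update (Function.update t k (t k + 1)) l (t l + 1)) +
        h (Function.update (Function.update t k (t k + 1)) l (t l - 1)) +
        (h (Function.update (Function.update t k (t k - 1)) l (t l + 1)) +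
        h (Function.update (Function.update t k (t k - 1)) l (t l - 1)))) := by
    unfold bdrySum
    refine Finset.sum_congr rfl fun k hk => ?_
    rw [oddDirs_update_even t k (even_add_one_of_mem hk),
      oddDirs_update_even t k (even_sub_one_of_mem hk), ← Finset.sum_add_distrib]
    refine Finset.sum_congr rfl fun l hl => ?_
    simp only [Function.update_of_ne (ne_of_mem_erase hl)]
  rw [key]
  refine sum_sum_erase_eq_zero _ _ fun k l hkl => ?_
  have comm : ∀ a b : ℤ, Function.update (Function.update t k a) l b =
      Function.update (Function.update t l b) k a := fun a b => Function.update_comm hkl a b t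
  simp only [comm]
  ring

theorem bdrySum_congr {h h' : (Fin d → ℤ) → ZMod 2} {t : Fin d → ℤ}
    (H : ∀ k ∈ oddDirs t, ∀ a, Even a → |a - t k| ≤ 1 →
      h (Function.update t k a) = h' (Function.update t k a)) : bdrySum h t = bdrySum h' t :=
  Finset.sum_congr rfl fun k hk => by
    rw [H k hk _ (even_add_one_of_mem hk) (by simp), H k hk _ (even_sub_one_of_mem hk) (by simp)]

theorem bdrySum_add (h h' : (Fin d → ℤ) → ZMod 2) (t : Fin d → ℤ) :
    bdrySum (fun s => h s + h' s) t = bdrySum h t + bdrySum h' t := by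
  unfold bdrySum
  rw [← Finset.sum_add_distrib]
  exact Finset.sum_congr rfl fun k _ => by ring

/-- The top-dimensional cell over a lattice point. -/
def topCell (u : Fin d → ℤ) : Fin d → ℤ := fun k => 2 * u k + 1

theorem oddDirs_topCell (u : Fin d → ℤ) : oddDirs (topCell u) = univ := by
  ext k; simp [mem_oddDirs, topCell]

theorem finsum_bdrySum_topCell (h : (Fin d → ℤ) → ZMod 2) {R : ℤ}
    (hR : ∀ t, (∃ k, R < |t k|) → h t = 0) :
    ∑ᶠ u : Fin d → ℤ, bdrySum h (topCell u) = 0 := by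
  have hfin : ∀ (k : Fin d) (a : ℤ), |a| ≤ 1 → (Function.support fun u : Fin d → ℤ =>
      h (Function.update (topCell u) k (topCell u k + a))).Finite := by
    intro k a ha
    refine (Set.Finite.pi' fun _ : Fin d => Set.finite_Icc (-(|R| + 2)) (|R| + 2)).subset
      fun u hu l => ?_
    by_contra hl
    rw [Set.mem_Icc, ← abs_le] at hl
    refine hu (hR _ ⟨l, ?_⟩)
    have := le_abs_self R
    by_cases hlk : l = k
    · subst hlk
      simp only [Function.update_self, topCell]
      rw [abs_le] at ha
      rw [not_le, lt_abs] at hl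
      rw [lt_abs]
      omega
    · simp only [Function.update_of_ne hlk, topCell]
      rw [not_le, lt_abs] at hl
      rw [lt_abs]
      omega
  unfold bdrySum
  simp only [oddDirs_topCell]
  rw [finsum_sum_comm]
  · refine Finset.sum_eq_zero fun k _ => ?_
    have h1 := hfin k 1 (by simp)
    have h2 := hfin k (-1) (by simp)
    simp only [← sub_eq_add_neg] at h2
    rw [finsum_add_distrib h1 h2]
    have e := finsum_comp_equiv (Equiv.addRight (Pi.single k (1 : ℤ)))
      (f := fun u : Fin d → ℤ => h (Function.update (topCell u) k (topCell u k - 1)))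
    rw [← e]
    have : ∀ u : Fin d → ℤ, Function.update (topCell (Equiv.addRight (Pi.single k (1 : ℤ)) u)) k
        (topCell (Equiv.addRight (Pi.single k (1 : ℤ)) u) k - 1) =
        Function.update (topCell u) k (topCell u k + 1) := by
      intro u
      funext l
      by_cases hlk : l = k
      · subst hlk
        simp [topCell]; ring
      · simp [topCell, hlk]
    simp only [this]
    exact CharTwo.add_self_eq_zero _
  · intro k _
    have h1 := hfin k 1 (by simp)
    have h2 := hfin k (-1) (by simp)
    simp only [← sub_eq_add_neg] at h2
    exact (h1.union h2).subset (Function.support_add _ _)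

end GridBoundary

/-! ### The chain homotopy argument -/

section Filling

variable [DecidableEq V] {X : Finset (Finset V)} {d : ℕ}

theorem card_oddDirs_update {t : Fin d → ℤ} {k : Fin d} (hk : k ∈ oddDirs t) {a : ℤ}
    (ha : Even a) : (oddDirs (Function.update t k a)).card + 1 = (oddDirs t).card := by
  rw [oddDirs_update_even t k ha, card_erase_add_one hk]

/-- `H t` is a small primitive of `F t + H (∂t)`, and vanishes if `t` is far away. -/
def IsFilling (X : Finset (Finset V)) (d : ℕ) (ε B η : ℝ) (R : ℤ)
    (F H : (Fin d → ℤ) → Finset V → ZMod 2) (t : Fin d → ℤ) : Prop :=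
  (∀ i, (oddDirs t).card + (i + 1) = d →
    (∀ σ ∈ cells X (i + 1), dlt (i + 1) (H t) σ = F t σ + bdrySum (fun s => H s σ) t) ∧
      normC X d i (H t) ≤ 2 / ε * (B ^ (oddDirs t).card * η)) ∧
  ((∃ k, R + (oddDirs t).card < |t k|) → ∀ σ, H t σ = 0)

variable {ε B η : ℝ} {R : ℤ} {F H : (Fin d → ℤ) → Finset V → ZMod 2} {t : Fin d → ℤ}

theorem memZ_of_isFilling
    (hF : ∀ t j, ∀ σ : Finset V, σ.card = j + 1 → dlt j (F t) σ = bdrySum (fun s => F s σ) t)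
    (hH : ∀ k ∈ oddDirs t, ∀ a, Even a → |a - t k| ≤ 1 →
      IsFilling X d ε B η R F H (Function.update t k a))
    {i : ℕ} (hi : (oddDirs t).card + i = d) :
    MemZ X i (fun σ => F t σ + bdrySum (fun s => H s σ) t) := by
  intro σ hσ
  have hσ' : σ.card = i + 1 + 1 := (mem_filter.1 hσ).2
  have h1 : dlt (i + 1) (fun σ => bdrySum (fun s => H s σ) t) σ =
      bdrySum (fun s => dlt (i + 1) (H s) σ) t := by
    unfold bdrySum
    rw [dlt_sum]
    exact Finset.sum_congr rfl fun k _ => dlt_add _ _ _ _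
  have h2 : bdrySum (fun s => dlt (i + 1) (H s) σ) t =
      bdrySum (fun s => F s σ + bdrySum (fun s => H s σ) s) t :=
    bdrySum_congr fun k hk a ha hat =>
      ((hH k hk a ha hat).1 i (by have := card_oddDirs_update hk ha; omega)).1 σ hσ
  rw [dlt_add, hF t _ σ hσ', h1, h2, bdrySum_add, bdrySum_bdrySum, add_zero]
  exact CharTwo.add_self_eq_zero _

theorem normC_le_of_isFilling (hε : 0 < ε) (hη : 0 ≤ η) (hB : B = 1 + 4 * d / ε)
    (hH : ∀ k ∈ oddDirs t, ∀ a, Even a → |a - t k| ≤ 1 →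
      IsFilling X d ε B η R F H (Function.update t k a))
    {i : ℕ} (hi : (oddDirs t).card + i = d) (hFt : normC X d i (F t) ≤ η) :
    normC X d i (fun σ => F t σ + bdrySum (fun s => H s σ) t) ≤ B ^ (oddDirs t).card * η := by
  refine (normC_add_le X d i _ _).trans ?_
  obtain hn | ⟨n, hn⟩ : (oddDirs t).card = 0 ∨ ∃ n, (oddDirs t).card = n + 1 := by
    cases (oddDirs t).card <;> simp
  · have h0 : oddDirs t = ∅ := card_eq_zero.1 hn
    simp only [bdrySum, h0, Finset.sum_empty, normC_zero]
    simpa using hFt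
  have hface : ∀ k ∈ oddDirs t, ∀ a, Even a → |a - t k| ≤ 1 →
      normC X d i (H (Function.update t k a)) ≤ 2 / ε * (B ^ n * η) := by
    intro k hk a ha hat
    have hc := card_oddDirs_update hk ha
    have := ((hH k hk a ha hat).1 i (by omega)).2
    rwa [show (oddDirs (Function.update t k a)).card = n by omega] at this
  have hb : normC X d i (fun σ => bdrySum (fun s => H s σ) t) ≤
      ∑ k ∈ oddDirs t, 2 * (2 / ε * (B ^ n * η)) := by
    unfold bdrySum
    refine (normC_sum_le X d i _ _).trans (Finset.sum_le_sum fun k hk => ?_)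
    refine (normC_add_le X d i _ _).trans ?_
    have h1 := hface k hk _ (even_add_one_of_mem hk) (by simp)
    have h2 := hface k hk _ (even_sub_one_of_mem hk) (by simp)
    linarith
  rw [Finset.sum_const, nsmul_eq_mul] at hb
  have hd0 : (0 : ℝ) ≤ 4 * d / ε := by positivity
  have hB1 : 1 ≤ B := by linarith
  have hBn : 1 ≤ B ^ n := one_le_pow₀ hB1
  have hcard : ((oddDirs t).card : ℝ) ≤ d := by exact_mod_cast (by omega : (oddDirs t).card ≤ d)
  have hq : 0 ≤ 2 * (2 / ε * (B ^ n * η)) := by positivity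
  have e : (d : ℝ) * (2 * (2 / ε * (B ^ n * η))) = (4 * d / ε) * (B ^ n * η) := by ring
  have h3 := mul_le_mul_of_nonneg_right hcard hq
  rw [hn, pow_succ, show B ^ n * B * η = B ^ n * η + (4 * d / ε) * (B ^ n * η) by rw [hB]; ring]
  nlinarith

theorem memB_of_zero_dimensional (hd : 1 ≤ d)
    (hF : ∀ t j, ∀ σ : Finset V, σ.card = j + 1 → dlt j (F t) σ = bdrySum (fun s => F s σ) t)
    (hfar : ∀ t, (∃ k, R < |t k|) → ∀ σ ∈ X, F t σ = 0) (ht : oddDirs t = ∅) :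
    MemB X d (F t) := by
  set k : Fin d := ⟨0, hd⟩
  have key : ∀ (m : ℕ) (t : Fin d → ℤ), oddDirs t = ∅ → R < t k + 2 * m → MemB X d (F t) := by
    intro m
    induction m with
    | zero =>
      intro t _ hR
      refine ⟨fun _ => 0, fun σ hσ => ?_⟩
      rw [dlt_zero]
      exact hfar t ⟨k, lt_of_lt_of_le (by simpa using hR) (le_abs_self _)⟩ σ (mem_filter.1 hσ).1
    | succ m ih =>
      intro t ht hR
      have hek : Even (t k) := by
        by_contra h
        exact notMem_empty k (ht ▸ mem_oddDirs.2 h)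
      obtain ⟨g, hg⟩ := ih (Function.update t k (t k + 2))
        (by rw [oddDirs_update_even t k (hek.add even_two), ht, erase_empty])
        (by simp only [Function.update_self]; push_cast at hR; linarith)
      have hodd : oddDirs (Function.update t k (t k + 1)) = {k} := by
        ext l
        rw [mem_oddDirs, mem_singleton]
        by_cases hl : l = k
        · subst hl
          simp only [Function.update_self, iff_true]
          rw [Int.even_add_one]; simpa using hek
        · rw [Function.update_of_ne hl]
          simp only [hl, iff_false, not_not]
          by_contra h
          exact notMem_empty l (ht ▸ mem_oddDirs.2 h)
      refine ⟨fun σ => g σ + F (Function.update t k (t k + 1)) σ, fun σ hσ => ?_⟩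
      have e := hF (Function.update t k (t k + 1)) d σ (mem_filter.1 hσ).2
      rw [dlt_add, e, ← hg σ hσ, bdrySum, hodd, Finset.sum_singleton]
      simp only [Function.update_self, Function.update_idem, add_sub_cancel_right,
        Function.update_eq_self]
      rw [show t k + 1 + 1 = t k + 2 by ring, ← add_assoc, CharTwo.add_self_eq_zero, zero_add]
  refine key (R - t k + 1).toNat t ht ?_
  have := Int.self_le_toNat (R - t k + 1)
  have h0 : 0 ≤ ((R - t k + 1).toNat : ℤ) := Int.natCast_nonneg _
  omega

theorem exists_isFilling (hd : 1 ≤ d) (hε : 0 < ε) (hη : 0 ≤ η) (hB : B = 1 + 4 * d / ε)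
    (hBη : B ^ d * η < ε)
    (hν : ∀ i < d, ∀ f : Finset V → ZMod 2, ¬ MemZ X i f →
      ε ≤ normC X d (i + 1) (dlt (i + 1) f) / distZ X d i f)
    (hμ : ∀ i < d, ∀ f : Finset V → ZMod 2, MemZ X i f → ¬ MemB X i f → ε ≤ normC X d i f)
    (hF : ∀ t j, ∀ σ : Finset V, σ.card = j + 1 → dlt j (F t) σ = bdrySum (fun s => F s σ) t)
    (hfar : ∀ t, (∃ k, R < |t k|) → ∀ σ ∈ X, F t σ = 0)
    (hsmall : ∀ t i, (oddDirs t).card + i = d → normC X d i (F t) ≤ η) (j : ℕ) (hj : j ≤ d) :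
    ∃ H : (Fin d → ℤ) → Finset V → ZMod 2,
      ∀ t, (oddDirs t).card < j → IsFilling X d ε B η R F H t := by
  induction j with
  | zero => exact ⟨fun _ _ => 0, fun t ht => absurd ht (Nat.not_lt_zero _)⟩
  | succ j ih =>
    obtain ⟨H, hH⟩ := ih (by omega)
    obtain ⟨i, hi⟩ : ∃ i, j + (i + 1) = d := ⟨d - j - 1, by omega⟩
    have hfaces : ∀ t, (oddDirs t).card = j → ∀ k ∈ oddDirs t, ∀ a, Even a → |a - t k| ≤ 1 →
        IsFilling X d ε B η R F H (Function.update t k a) := fun t ht k hk a ha _ =>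
      hH _ (by have := card_oddDirs_update hk ha; omega)
    have step : ∀ t, ∃ g : Finset V → ZMod 2, (oddDirs t).card = j →
        (∀ σ ∈ cells X (i + 1), dlt (i + 1) g σ = F t σ + bdrySum (fun s => H s σ) t) ∧
        normC X d i g ≤ 2 / ε * (B ^ j * η) ∧
        ((∃ k, R + j < |t k|) → ∀ σ, g σ = 0) := by
      intro t
      by_cases ht : (oddDirs t).card = j
      swap
      · exact ⟨fun _ => 0, fun h => absurd h ht⟩
      set c : Finset V → ZMod 2 := fun σ => F t σ + bdrySum (fun s => H s σ) t with hc
      have hnorm : normC X d (i + 1) c ≤ B ^ j * η := by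
        rw [← ht]
        exact normC_le_of_isFilling hε hη hB (hfaces t ht) (by omega) (hsmall t _ (by omega))
      have hd0 : (0 : ℝ) ≤ 4 * d / ε := by positivity
      have hB1 : 1 ≤ B := by linarith
      by_cases hft : ∃ k, R + j < |t k|
      · refine ⟨fun _ => 0, fun _ => ⟨fun σ hσ => ?_, ?_, fun _ _ => rfl⟩⟩
        · obtain ⟨k, hk⟩ := hft
          have h1 : bdrySum (fun s => H s σ) t = bdrySum (fun _ => 0) t := by
            refine bdrySum_congr fun l hl a ha hat => (hfaces t ht l hl a ha hat).2 ⟨k, ?_⟩ σ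
            have hcard := card_oddDirs_update hl ha
            by_cases hkl : k = l
            · subst hkl
              rw [Function.update_self]
              have := abs_sub_abs_le_abs_sub (t k) a
              rw [abs_sub_comm] at this
              omega
            · rw [Function.update_of_ne hkl]
              omega
          rw [dlt_zero, h1, hfar t ⟨k, by omega⟩ σ (mem_filter.1 hσ).1]
          simp [bdrySum]
        · rw [normC_zero]
          positivity
      · have hcB : MemB X (i + 1) c := by
          rcases Nat.eq_zero_or_pos j with rfl | hj0
          · have h0 : oddDirs t = ∅ := card_eq_zero.1 ht
            obtain rfl : i + 1 = d := by omega
            have : c = F t := by funext σ; simp [hc, bdrySum, h0]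
            rw [this]
            exact memB_of_zero_dimensional hd hF hfar h0
          · by_contra hcon
            have h1 := hμ (i + 1) (by omega) c
              (memZ_of_isFilling hF (hfaces t ht) (by omega)) hcon
            have h2 : B ^ j * η ≤ B ^ d * η :=
              mul_le_mul_of_nonneg_right (pow_le_pow_right₀ hB1 (by omega)) hη
            linarith
        obtain ⟨g, hg1, hg2⟩ := exists_small_primitive hε (hν i (by omega)) hcB
        exact ⟨g, fun _ => ⟨hg1, hg2.trans (mul_le_mul_of_nonneg_left hnorm (by positivity)),
          fun h => absurd h hft⟩⟩
    choose g hg using step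
    refine ⟨fun t => if (oddDirs t).card = j then g t else H t, fun t ht => ?_⟩
    have hbd : ∀ σ, bdrySum (fun s => (if (oddDirs s).card = j then g s else H s) σ) t =
        bdrySum (fun s => H s σ) t := fun σ => bdrySum_congr fun k hk a ha _ => by
      have := card_oddDirs_update hk ha
      rw [if_neg (by omega)]
    unfold IsFilling
    simp only [hbd]
    by_cases h : (oddDirs t).card = j
    · obtain ⟨h1, h2, h3⟩ := hg t h
      simp only [h, if_true]
      refine ⟨fun i' hi' => ?_, h3⟩
      obtain rfl : i' = i := by omega
      exact ⟨h1, h2⟩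
    · simp only [h, if_false]
      exact hH t (by omega)

theorem false_of_small_intersections (hd : 1 ≤ d) (hε : 0 < ε) (hη : 0 ≤ η)
    (hB : B = 1 + 4 * d / ε) (hBη : B ^ d * η < ε) (hBη1 : B ^ d * η < 1)
    (hX : ∀ F ∈ X, ∀ G ⊆ F, G ∈ X) (hne : (cells X d).Nonempty)
    (hν : ∀ i < d, ∀ f : Finset V → ZMod 2, ¬ MemZ X i f →
      ε ≤ normC X d (i + 1) (dlt (i + 1) f) / distZ X d i f)
    (hμ : ∀ i < d, ∀ f : Finset V → ZMod 2, MemZ X i f → ¬ MemB X i f → ε ≤ normC X d i f)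
    (hF : ∀ t j, ∀ σ : Finset V, σ.card = j + 1 → dlt j (F t) σ = bdrySum (fun s => F s σ) t)
    (hfar : ∀ t, (∃ k, R < |t k|) → ∀ σ ∈ X, F t σ = 0)
    (hsmall : ∀ t i, (oddDirs t).card + i = d → normC X d i (F t) ≤ η)
    (hpt : ∀ v : V, ∃ u : Fin d → ℤ, ∀ w, F (topCell w) {v} = if w = u then 1 else 0) :
    False := by
  obtain ⟨H, hH⟩ := exists_isFilling hd hε hη hB hBη hν hμ hF hfar hsmall d le_rfl
  have htop : ∀ w : Fin d → ℤ, ∀ σ ∈ cells X 0,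
      F (topCell w) σ + bdrySum (fun s => H s σ) (topCell w) = 0 := by
    intro w
    have hcard : (oddDirs (topCell w)).card = d := by simp [oddDirs_topCell]
    have hfaces : ∀ k ∈ oddDirs (topCell w), ∀ a, Even a → |a - topCell w k| ≤ 1 →
        IsFilling X d ε B η R F H (Function.update (topCell w) k a) := fun k hk a ha _ =>
      hH _ (by have := card_oddDirs_update hk ha; omega)
    have hZ := memZ_of_isFilling (i := 0) hF hfaces (by omega)
    have hn := normC_le_of_isFilling (i := 0) hε hη hB hfaces (by omega)
      (hsmall _ _ (by omega))
    rw [hcard] at hn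
    have hMB : MemB X 0 (fun σ => F (topCell w) σ + bdrySum (fun s => H s σ) (topCell w)) := by
      by_contra hcon
      have := hμ 0 (by omega) _ hZ hcon
      linarith
    obtain ⟨g, hg⟩ := hMB
    have hconst : ∀ σ, dlt 0 g σ = g ∅ := fun σ => by simp [dlt]
    by_contra! hcon
    obtain ⟨σ, hσ, hσ0⟩ := hcon
    have hg0 : g ∅ ≠ 0 := by rw [← hconst σ, ← hg σ hσ]; exact hσ0
    have := normC_eq_one (d := d) hX hne
      (f := fun σ => F (topCell w) σ + bdrySum (fun s => H s σ) (topCell w))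
      fun τ hτ => ((hg τ hτ).trans (hconst τ)).trans_ne hg0
    linarith
  obtain ⟨τ, hτ⟩ := hne
  simp only [cells, mem_filter] at hτ
  obtain ⟨v, hv⟩ : τ.Nonempty := card_pos.1 (by omega)
  have hvX : {v} ∈ cells X 0 := by
    simp only [cells, mem_filter, card_singleton, zero_add, and_true]
    exact hX τ hτ.1 _ (singleton_subset_iff.2 hv)
  obtain ⟨u, hu⟩ := hpt v
  have h1 : ∑ᶠ w, bdrySum (fun s => if (oddDirs s).card < d then H s {v} else 0) (topCell w) = 0 := by
    refine finsum_bdrySum_topCell _ (R := R + d) fun t ⟨k, hk⟩ => ?_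
    split_ifs with h
    · exact (hH t h).2 ⟨k, by omega⟩ _
    · rfl
  have h2 : ∀ w, bdrySum (fun s => if (oddDirs s).card < d then H s {v} else 0) (topCell w) =
      if w = u then 1 else 0 := by
    intro w
    have : bdrySum (fun s => if (oddDirs s).card < d then H s {v} else 0) (topCell w) =
        bdrySum (fun s => H s {v}) (topCell w) := bdrySum_congr fun k hk a ha _ => by
      have h3 := card_oddDirs_update hk ha
      rw [oddDirs_topCell, card_univ, Fintype.card_fin] at h3
      rw [if_pos (by omega)]
    rw [this, ← hu w]
    exact (CharTwo.add_eq_zero.1 (htop w _ hvX)).symm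
  rw [funext h2, finsum_eq_single _ u fun w hw => if_neg hw, if_pos rfl] at h1
  exact one_ne_zero h1

end Filling

/-! ### Intersection cochains of a continuous map -/

section Geometry

theorem exists_common_point_of_near {Y ι : Type*} [PseudoMetricSpace Y] (s : Finset ι)
    (K : ι → Set Y) (hK : ∀ i ∈ s, IsCompact (K i)) (hc : ∀ i ∈ s, IsClosed (K i)) :
    ∃ δ > 0, ∀ p, ∃ z, ∀ i ∈ s, (∃ y ∈ K i, dist p y < δ) → z ∈ K i := by
  obtain ⟨δ, hδ, h⟩ := lebesgue_number_lemma_of_metric (s := ⋃ i ∈ s, K i)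
    (c := fun z : Y => ⋂ i ∈ s.filter fun i => z ∉ K i, (K i)ᶜ)
    (s.isCompact_biUnion hK)
    (fun z => isOpen_biInter_finset fun i hi => (hc i (mem_filter.1 hi).1).isOpen_compl)
    (fun z _ => Set.mem_iUnion.2 ⟨z, Set.mem_iInter₂.2 fun i hi => (mem_filter.1 hi).2⟩)
  refine ⟨δ / 2, half_pos hδ, fun p => ?_⟩
  by_cases hp : ∃ i ∈ s, ∃ y ∈ K i, dist p y < δ / 2
  · obtain ⟨i, hi, y, hy, hpy⟩ := hp
    obtain ⟨z, hz⟩ := h y (Set.mem_biUnion hi hy)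
    refine ⟨z, fun j hj ⟨y', hy', hpy'⟩ => ?_⟩
    by_contra hzj
    have hb : y' ∈ Metric.ball y δ := by
      rw [Metric.mem_ball]
      have := dist_triangle_left y' y p
      linarith
    exact Set.mem_iInter₂.1 (hz hb) j (mem_filter.2 ⟨hj, hzj⟩) hy'
  · push Not at hp
    exact ⟨p, fun i hi ⟨y, hy, hpy⟩ => absurd hpy (not_lt.2 (hp i hi y hy))⟩

variable [Fintype V] [DecidableEq V] {X : Finset (Finset V)} {d : ℕ}

theorem mem_faceReal_iff (hX : ∀ F ∈ X, ∀ G ⊆ F, G ∈ X) {σ : Finset V} (hσ : σ ∈ X)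
    {x : V → ℝ} : x ∈ faceReal X σ ↔ x ∈ stdSimplex ℝ V ∧ ∀ v, v ∉ σ → x v = 0 := by
  constructor
  · rintro ⟨⟨h1, h2, _⟩, h3⟩
    exact ⟨⟨h1, h2⟩, fun v hv => by_contra fun h => hv (h3 v h)⟩
  · rintro ⟨⟨h1, h2⟩, h3⟩
    have h4 : ∀ v, x v ≠ 0 → v ∈ σ := fun v hv => by_contra fun h => hv (h3 v h)
    exact ⟨⟨h1, h2, hX σ hσ _ fun v hv => h4 v (mem_filter.1 hv).2⟩, h4⟩

theorem faceReal_eq (hX : ∀ F ∈ X, ∀ G ⊆ F, G ∈ X) {σ : Finset V} (hσ : σ ∈ X) :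
    faceReal X σ = stdSimplex ℝ V ∩ ⋂ v ∈ (σ : Set V)ᶜ, {x : V → ℝ | x v = 0} := by
  ext x
  simp [mem_faceReal_iff hX hσ]

theorem isCompact_faceReal (hX : ∀ F ∈ X, ∀ G ⊆ F, G ∈ X) {σ : Finset V} (hσ : σ ∈ X) :
    IsCompact (faceReal X σ) := by
  rw [faceReal_eq hX hσ]
  exact (isCompact_stdSimplex ℝ V).inter_right
    (isClosed_biInter fun v _ => isClosed_eq (continuous_apply v) continuous_const)

theorem convex_faceReal (hX : ∀ F ∈ X, ∀ G ⊆ F, G ∈ X) {σ : Finset V} (hσ : σ ∈ X) :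
    Convex ℝ (faceReal X σ) := by
  intro x hx y hy a b ha hb hab
  rw [mem_faceReal_iff hX hσ] at *
  refine ⟨convex_stdSimplex ℝ V hx.1 hy.1 ha hb hab, fun v hv => ?_⟩
  simp [hx.2 v hv, hy.2 v hv]

theorem faceReal_mono {σ τ : Finset V} (h : σ ⊆ τ) : faceReal X σ ⊆ faceReal X τ :=
  fun _ hx => ⟨hx.1, fun v hv => h (hx.2 v hv)⟩

theorem isCompact_realization (hX : ∀ F ∈ X, ∀ G ⊆ F, G ∈ X) : IsCompact (realization X) := by
  have : realization X = ⋃ σ ∈ X, faceReal X σ := by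
    ext x
    simp only [Set.mem_iUnion, exists_prop]
    constructor
    · intro hx
      exact ⟨_, hx.2.2, hx, fun v hv => by simpa using hv⟩
    · rintro ⟨σ, _, hx⟩
      exact hx.1
  rw [this]
  exact X.isCompact_biUnion fun σ hσ => isCompact_faceReal hX hσ

theorem single_mem_faceReal (hX : ∀ F ∈ X, ∀ G ⊆ F, G ∈ X) {σ : Finset V} (hσ : σ ∈ X)
    {v : V} (hv : v ∈ σ) : (Pi.single v 1 : V → ℝ) ∈ faceReal X σ := by
  rw [mem_faceReal_iff hX hσ]
  refine ⟨single_mem_stdSimplex ℝ v, fun w hw => Pi.single_eq_of_ne ?_ 1⟩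
  rintro rfl
  exact hw hv

theorem dist_single_single_le (v w : V) :
    dist (Pi.single v 1 : V → ℝ) (Pi.single w 1) ≤ 1 := by
  refine (dist_pi_le_iff zero_le_one).2 fun u => ?_
  rw [Real.dist_eq, abs_le]
  simp only [Pi.single_apply]
  split_ifs <;> norm_num

/-- The intersection cochain of the grid cell `t` with the `N`-fold subdivision of the map `r`
to the lattice points. -/
noncomputable def intersectionCochain (r : (V → ℝ) → Fin d → ℤ) (N : ℕ) (t : Fin d → ℤ)
    (σ : Finset V) : ZMod 2 :=
  (sd barycenter)^[N] (fun L => cellCochain t (List.finRange d) (L.map r))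
    ((vertexList σ).map fun v => Pi.single v (1 : ℝ))

variable (r : (V → ℝ) → Fin d → ℤ) (N : ℕ)

theorem dlt_intersectionCochain (t : Fin d → ℤ) (j : ℕ) (σ : Finset V) (hσ : σ.card = j + 1) :
    dlt j (intersectionCochain r N t) σ =
      bdrySum (fun s => intersectionCochain r N s σ) t := by
  have h1 : cobd (fun L : List (V → ℝ) => cellCochain t (List.finRange d) (L.map r)) =
      fun L => ∑ k ∈ oddDirs t,
        (cellCochain (Function.update t k (t k + 1)) (List.finRange d) (L.map r) +
          cellCochain (Function.update t k (t k - 1)) (List.finRange d) (L.map r)) := by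
    funext L
    rw [cobd_comp_map, cobd_cellCochain t (List.nodup_finRange d), ← Fin.sum_univ_def, oddDirs,
      Finset.sum_filter]
    refine Finset.sum_congr rfl fun k _ => ?_
    by_cases h : Even (t k) <;> simp [h]
  unfold intersectionCochain
  rw [dlt_comp_vertexList (fun L => (sd barycenter)^[N]
      (fun L => cellCochain t (List.finRange d) (L.map r)) (L.map fun v => Pi.single v (1 : ℝ))) hσ,
    cobd_comp_map, cobd_sd_iterate, h1, sd_iterate_sum, bdrySum]
  simp only [sd_iterate_add]

theorem intersectionCochain_topCell_singleton (v : V) (w : Fin d → ℤ) :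
    intersectionCochain r N (topCell w) {v} = if w = r (Pi.single v 1) then 1 else 0 := by
  rw [intersectionCochain, vertexList_singleton, List.map_singleton,
    sd_iterate_singleton _ barycenter_singleton, List.map_singleton, cellCochain_singleton _ _
    fun k _ => mem_oddDirs.1 (by rw [oddDirs_topCell]; exact mem_univ k)]
  congr 1
  simp only [topCell, funext_iff, List.mem_finRange, forall_const, eq_iff_iff]
  exact forall_congr' fun k => by omega

theorem exists_near_of_intersectionCochain_ne_zero (hX : ∀ F ∈ X, ∀ G ⊆ F, G ∈ X) {δ : ℝ}
    (hr : ∀ x ∈ realization X, ∀ y ∈ realization X, dist x y < δ → ∀ k, |r x k - r y k| ≤ 1)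
    (hN : (1 - ((d : ℝ) + 1)⁻¹) ^ N < δ) {σ : Finset V} (hσ : σ ∈ X) (hcard : σ.card ≤ d + 1)
    {t : Fin d → ℤ} (h : intersectionCochain r N t σ ≠ 0) :
    ∃ x ∈ faceReal X σ, ∀ k, |2 * r x k - t k| ≤ 4 := by
  obtain ⟨M, hM1, hM2, hM3, hM4⟩ := exists_small_of_sd_iterate_ne_zero (d := d)
    (convex_faceReal hX hσ) zero_le_one N _ _ (by simpa [length_vertexList] using hcard)
    (by
      intro x hx
      obtain ⟨v, hv, rfl⟩ := List.mem_map.1 hx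
      exact single_mem_faceReal hX hσ (mem_vertexList.1 hv))
    (by
      intro x hx y hy
      obtain ⟨v, hv, rfl⟩ := List.mem_map.1 hx
      obtain ⟨w, hw, rfl⟩ := List.mem_map.1 hy
      exact dist_single_single_le v w) h
  have hclose : ∀ x ∈ M, ∀ y ∈ M, ∀ k, |r x k - r y k| ≤ 1 := fun x hx y hy =>
    hr x (hM2 x hx).1 y (hM2 y hy).1
      (lt_of_le_of_lt (hM3 x hx y hy) (by rwa [mul_one]))
  obtain ⟨x, hx⟩ : ∃ x, x ∈ M := by
    refine List.exists_mem_of_ne_nil M ?_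
    rintro rfl
    exact hM4 (cellCochain_nil_right t _)
  refine ⟨x, hM2 x hx, fun k => ?_⟩
  obtain ⟨u, hu, huk⟩ := exists_near_of_cellCochain_ne_zero t (List.finRange d) (M.map r)
    (by
      intro u hu v hv
      obtain ⟨y, hy, rfl⟩ := List.mem_map.1 hu
      obtain ⟨z, hz, rfl⟩ := List.mem_map.1 hv
      exact hclose y hy z hz) hM4 k (List.mem_finRange k)
  obtain ⟨y, hy, rfl⟩ := List.mem_map.1 hu
  have := hclose x hx y hy k
  rw [abs_le] at *
  omega

end Geometry

theorem abs_floor_div_sub_le_one {a b η : ℝ} (hη : 0 < η) (h : |a - b| ≤ η) :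
    |⌊a / η⌋ - ⌊b / η⌋| ≤ 1 := by
  have key : ∀ a b : ℝ, |a - b| ≤ η → ⌊a / η⌋ ≤ ⌊b / η⌋ + 1 := by
    intro a b h
    rw [← Int.floor_add_one]
    refine Int.floor_le_floor ?_
    rw [div_add_one hη.ne', div_le_div_iff_of_pos_right hη]
    linarith [(abs_le.1 h).2]
  have h1 := key a b h
  have h2 := key b a (by rwa [abs_sub_comm])
  rw [abs_le]
  omega

theorem abs_sub_le_of_abs_floor_div_sub_le {a η : ℝ} (hη : 0 < η) {t : ℤ}
    (h : |2 * ⌊a / η⌋ - t| ≤ 4) : |η * t / 2 - a| ≤ 3 * η := by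
  have h1 := Int.floor_le (a / η)
  have h2 := Int.lt_floor_add_one (a / η)
  rw [abs_le] at h
  have h3 : (-4 : ℝ) ≤ 2 * ⌊a / η⌋ - t := by exact_mod_cast h.1
  have h4 : 2 * (⌊a / η⌋ : ℝ) - t ≤ 4 := by exact_mod_cast h.2
  have e : a = η * (a / η) := by field_simp
  have e' : η * t / 2 - a = η * (t / 2 - a / η) := by rw [mul_sub, ← e]; ring
  rw [e', abs_mul, abs_of_pos hη, mul_comm 3 η]
  refine mul_le_mul_of_nonneg_left ?_ hη.le
  rw [abs_le]
  constructor <;> linarith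


/-- Dotterrer–Kaufman–Wagner: cosystolic expanders are topological
expanders.  For every `d ≥ 1` and `ε > 0` there is `ε' > 0` such that every finite pure
`d`-dimensional complex which is an `ε`-cosystolic expander (i.e. for all `i ≤ d-1`:
`νᵢ(X) ≥ ε`, stated as `‖δᵢ f‖/‖⌈f⌉‖ ≥ ε` for all `f ∈ Cⁱ \ Zⁱ`, and `μᵢ(X) ≥ ε`,
stated as `‖f‖ ≥ ε` for all `f ∈ Zⁱ \ Bⁱ`) is an `ε'`-topological expander. -/
theorem cosystolic_expanders_are_topological_expanders (d : ℕ) (hd : 1 ≤ d)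
    (ε : ℝ) (hε : 0 < ε) :
    ∃ ε' : ℝ, 0 < ε' ∧
      ∀ (V : Type) [Fintype V] [DecidableEq V] (X : Finset (Finset V)),
        (∀ F ∈ X, ∀ G ⊆ F, G ∈ X) →
        (∀ F ∈ X, ∃ G ∈ X, G.card = d + 1 ∧ F ⊆ G) →
        (∀ i < d, ∀ f : Finset V → ZMod 2, ¬ MemZ X i f →
          ε ≤ normC X d (i + 1) (dlt (i + 1) f) / distZ X d i f) →
        (∀ i < d, ∀ f : Finset V → ZMod 2, MemZ X i f → ¬ MemB X i f →
          ε ≤ normC X d i f) →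
        ∀ f : (V → ℝ) → (Fin d → ℝ), ContinuousOn f (realization X) →
          ∃ z : Fin d → ℝ,
            ε' * ((cells X d).card : ℝ) ≤
              ({σ : Finset V | σ ∈ cells X d ∧ z ∈ f '' faceReal X σ}).ncard := by
  set B : ℝ := 1 + 4 * d / ε with hB
  have hB1 : 1 ≤ B := le_add_of_nonneg_right (by positivity)
  have hBpos : 0 < B ^ d := by positivity
  have hmin : 0 < min ε 1 := lt_min hε one_pos
  refine ⟨min ε 1 / (2 * B ^ d), by positivity, ?_⟩
  intro V _ _ X hX hpure hν hμ f hf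
  set ε' : ℝ := min ε 1 / (2 * B ^ d) with hε'
  have hε'0 : 0 < ε' := by positivity
  have hBε' : B ^ d * ε' < min ε 1 := by
    have : B ^ d * ε' = min ε 1 / 2 := by rw [hε']; field_simp
    linarith
  by_contra! hcon
  have hne : (cells X d).Nonempty := by
    by_contra h
    rw [not_nonempty_iff_eq_empty] at h
    have := hcon 0
    rw [h, card_empty, Nat.cast_zero, mul_zero] at this
    exact absurd this (not_lt.2 (Nat.cast_nonneg _))
  have hcard : ∀ σ ∈ X, σ.card ≤ d + 1 := fun σ hσ => by
    obtain ⟨τ, _, h1, h2⟩ := hpure σ hσ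
    exact h1 ▸ card_le_card h2
  have hreal : ∀ σ, faceReal X σ ⊆ realization X := fun σ x hx => hx.1
  have hK : ∀ σ ∈ X, IsCompact (f '' faceReal X σ) := fun σ hσ =>
    (isCompact_faceReal hX hσ).image_of_continuousOn (hf.mono (hreal σ))
  obtain ⟨δ, hδ, hnear⟩ := exists_common_point_of_near X (fun σ => f '' faceReal X σ) hK
    fun σ hσ => (hK σ hσ).isClosed
  set η : ℝ := δ / 4 with hη
  have hη0 : 0 < η := by positivity
  obtain ⟨δ', hδ', hunif⟩ := Metric.uniformContinuousOn_iff.1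
    ((isCompact_realization hX).uniformContinuousOn_of_continuous hf) η hη0
  obtain ⟨N, hN⟩ : ∃ N : ℕ, (1 - ((d : ℝ) + 1)⁻¹) ^ N < δ' :=
    exists_pow_lt_of_lt_one hδ' (sub_lt_self _ (by positivity))
  obtain ⟨C, hC⟩ := (((isCompact_realization hX).image_of_continuousOn hf).isBounded).exists_norm_le
  set r : (V → ℝ) → Fin d → ℤ := fun x k => ⌊f x k / η⌋ with hr
  have hsupp : ∀ t, ∀ σ ∈ X, intersectionCochain r N t σ ≠ 0 →
      ∃ x ∈ faceReal X σ, ∀ k, |2 * r x k - t k| ≤ 4 := fun t σ hσ h =>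
    exists_near_of_intersectionCochain_ne_zero r N hX
      (fun x hx y hy hxy k => abs_floor_div_sub_le_one hη0
        ((dist_le_pi_dist (f x) (f y) k).trans (hunif x hx y hy hxy).le))
      hN hσ (hcard σ hσ) h
  refine false_of_small_intersections (X := X) (d := d) (B := B) (η := ε')
    (R := ⌈2 * (C / η) + 6⌉) (F := intersectionCochain r N) hd hε hε'0.le hB
    (hBε'.trans_le (min_le_left _ _)) (hBε'.trans_le (min_le_right _ _)) hX hne hν hμ
    (dlt_intersectionCochain r N) ?_ ?_
    fun v => ⟨_, intersectionCochain_topCell_singleton r N v⟩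
  · rintro t ⟨k, hk⟩ σ hσ
    by_contra h
    obtain ⟨x, hx, hxt⟩ := hsupp t σ hσ h
    have h1 := hxt k
    have h2 : |f x k| ≤ C := (norm_le_pi_norm (f x) k).trans (hC _ ⟨x, hx.1, rfl⟩)
    have h3 : |f x k / η| ≤ C / η := by
      rw [abs_div, abs_of_pos hη0]
      exact div_le_div_of_nonneg_right h2 hη0.le
    have h4 := Int.floor_le (f x k / η)
    have h5 := Int.lt_floor_add_one (f x k / η)
    have h6 : 2 * (C / η) + 6 < |(t k : ℝ)| := by
      rw [← Int.cast_abs]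
      exact (Int.le_ceil _).trans_lt (by exact_mod_cast hk)
    have h7 : |2 * (r x k : ℝ) - t k| ≤ 4 := by exact_mod_cast h1
    simp only [hr] at h7
    rw [abs_le] at h3 h7
    rw [lt_abs] at h6
    rcases h6 with h6 | h6 <;> linarith
  · intro t i hi
    obtain ⟨z, hz⟩ := hnear fun k => η * t k / 2
    refine normC_le_of_support (S := (cells X d).filter fun τ => z ∈ f '' faceReal X τ) hX
      (by omega) ?_ ?_ hε'0.le
    · intro τ hτ F hFτ _ hF0
      have hτX := (mem_filter.1 hτ).1
      obtain ⟨x, hx, hxt⟩ := hsupp t F (hX τ hτX F hFτ) hF0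
      refine mem_filter.2 ⟨hτ, hz τ hτX ⟨f x, ⟨x, faceReal_mono hFτ hx, rfl⟩, ?_⟩⟩
      refine lt_of_le_of_lt ((dist_pi_le_iff (by positivity : 0 ≤ 3 * η)).2 fun k => ?_)
        (by rw [hη]; linarith : 3 * η < δ)
      exact abs_sub_le_of_abs_floor_div_sub_le hη0 (hxt k)
    · refine le_trans (le_of_eq ?_) (hcon z).le
      rw [← Set.ncard_coe_finset]
      congr 2
      ext τ
      simp
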